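/- arXiv:1802.04428 — 6 statements merged into one kernel-verified Lean document; each statement's English description precedes it below -/
import Mathlib

section
/- Let α be a type, p : ℕ, and for each i : Fin p let m i, n i : ℕ, and let t : (i : Fin p) → Fin (m i) → α → ℤ and u : (i : Fin p) → Fin (n i) → α → ℤ. Define φ z x := ∃ i : Fin p, (∀ j : Fin (m i), t i j x ≤ z) ∧ (∀ k : Fin (n i), z ≤ u i k x). If for every x : α there exists i : Fin p with t i j x ≤ u i k x for all j and k, then there exists f : α → ℤ such that for every x : α, φ (f x) x holds, and moreover for every x : α, either f x = 0, or f x = t i j x for some i and j, or f x = u i k x for some i and k. -/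
theorem ssi_term_valued_solution (α : Type*) (p : ℕ) (m n : Fin p → ℕ)
    (t : (i : Fin p) → Fin (m i) → α → ℤ) (u : (i : Fin p) → Fin (n i) → α → ℤ)
    (h : ∀ x : α, ∃ i : Fin p, ∀ j : Fin (m i), ∀ k : Fin (n i), t i j x ≤ u i k x) :
    ∃ f : α → ℤ,
      (∀ x : α,
        ∃ i : Fin p, (∀ j : Fin (m i), t i j x ≤ f x) ∧ (∀ k : Fin (n i), f x ≤ u i k x)) ∧
      (∀ x : α,
        f x = 0 ∨ (∃ i : Fin p, ∃ j : Fin (m i), f x = t i j x) ∨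
          (∃ i : Fin p, ∃ k : Fin (n i), f x = u i k x)) := by
  have key : ∀ x : α, ∃ z : ℤ,
      (∃ i : Fin p, (∀ j : Fin (m i), t i j x ≤ z) ∧ (∀ k : Fin (n i), z ≤ u i k x)) ∧
      (z = 0 ∨ (∃ i : Fin p, ∃ j : Fin (m i), z = t i j x) ∨
          (∃ i : Fin p, ∃ k : Fin (n i), z = u i k x)) := by
    intro x
    obtain ⟨i, hi⟩ := h x
    rcases isEmpty_or_nonempty (Fin (m i)) with hm | hm
    · rcases isEmpty_or_nonempty (Fin (n i)) with hn | hn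
      · exact ⟨0, ⟨i, fun j => hm.elim j, fun k => hn.elim k⟩, Or.inl rfl⟩
      · obtain ⟨k, hk⟩ := Finite.exists_min (fun k => u i k x)
        exact ⟨u i k x, ⟨i, fun j => hm.elim j, hk⟩, Or.inr (Or.inr ⟨i, k, rfl⟩)⟩
    · obtain ⟨j, hj⟩ := Finite.exists_max (fun j => t i j x)
      exact ⟨t i j x, ⟨i, hj, hi j⟩, Or.inr (Or.inl ⟨i, j, rfl⟩)⟩
  choose f hf using key
  exact ⟨f, fun x => (hf x).1, fun x => (hf x).2⟩
end

section
/- Let m, p : ℕ, let w : Fin p → (Fin m → ℤ) and d : Fin p → ℤ, and let S := {x : Fin m → ℤ | ∀ j : Fin p, d j ≤ ∑ l, w j l * x l} be a finite intersection of integer half-spaces. Then for every x : Fin m → ℤ, every c : Fin m → ℤ, and every k : ℕ: (for every natural number i ≤ k, x + i • c ∈ S) if and only if (x ∈ S and x + k • c ∈ S), where i • c denotes the pointwise scalar multiple and + is pointwise addition. -/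
def halfspaceInter (m p : ℕ) (w : Fin p → Fin m → ℤ) (d : Fin p → ℤ) :
    Set (Fin m → ℤ) :=
  {x : Fin m → ℤ | ∀ j : Fin p, d j ≤ ∑ l, w j l * x l}

theorem progression_in_halfspaces_iff_endpoints (m p : ℕ)
    (w : Fin p → Fin m → ℤ) (d : Fin p → ℤ)
    (x c : Fin m → ℤ) (k : ℕ) :
    (∀ i : ℕ, i ≤ k → x + i • c ∈ halfspaceInter m p w d) ↔
      (x ∈ halfspaceInter m p w d ∧ x + k • c ∈ halfspaceInter m p w d) := by
  have key : ∀ (j : Fin p) (i : ℕ), ∑ l, w j l * (x + i • c) l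
      = ∑ l, w j l * x l + (i : ℤ) * ∑ l, w j l * c l := by
    intro j i
    rw [Finset.mul_sum, ← Finset.sum_add_distrib]
    refine Finset.sum_congr rfl fun l _ => ?_
    rw [Pi.add_apply, Pi.smul_apply, nsmul_eq_mul]
    ring
  constructor
  · intro h
    exact ⟨by simpa using h 0 (Nat.zero_le k), h k le_rfl⟩
  · rintro ⟨h0, hk⟩ i hi j
    have h0j : d j ≤ ∑ l, w j l * x l := h0 j
    have hkj : d j ≤ ∑ l, w j l * (x + k • c) l := hk j
    rw [key] at hkj ⊢
    have hi' : (i : ℤ) ≤ k := by exact_mod_cast hi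
    have hi0 : (0 : ℤ) ≤ i := Int.natCast_nonneg i
    rcases le_total 0 (∑ l, w j l * c l) with hc | hc
    · have := mul_nonneg hi0 hc
      linarith
    · have := mul_le_mul_of_nonpos_right hi' hc
      linarith
end

section
/- Let m, p : ℕ, let w : Fin p → (Fin m → ℤ) and d : Fin p → ℤ, let S := {x : Fin m → ℤ | ∀ j : Fin p, d j ≤ ∑ l, w j l * x l}, and let c : Fin m → ℤ. Define the one-step relation r on Fin m → ℤ by r x y := (x ∈ S ∧ x + c ∈ S ∧ y = x + c). Then for all x and y: Relation.ReflTransGen r x y holds if and only if x = y, or there exists k : ℕ with 1 ≤ k such that y = x + k • c, x ∈ S, and y ∈ S. -/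
theorem halfspaceInter_mid (m p : ℕ) (w : Fin p → Fin m → ℤ) (d : Fin p → ℤ)
    (c x : Fin m → ℤ) (k i : ℕ) (hi : i ≤ k) (hx : x ∈ halfspaceInter m p w d)
    (hy : x + k • c ∈ halfspaceInter m p w d) : x + i • c ∈ halfspaceInter m p w d := by
  have key : ∀ (n : ℕ) (j : Fin p), ∑ l, w j l * (x + n • c) l
      = ∑ l, w j l * x l + n * ∑ l, w j l * c l := by
    intro n j
    rw [Finset.mul_sum, ← Finset.sum_add_distrib]
    refine Finset.sum_congr rfl fun l _ => ?_
    rw [Pi.add_apply, Pi.smul_apply, nsmul_eq_mul]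
    ring
  intro j
  have h1 := hx j
  have h2 := hy j
  rw [key] at h2 ⊢
  have hi' : (i : ℤ) ≤ k := by exact_mod_cast hi
  have h0 : (0 : ℤ) ≤ i := by positivity
  rcases le_total 0 (∑ l, w j l * c l) with h | h
  · nlinarith [mul_nonneg h0 h]
  · nlinarith [mul_le_mul_of_nonpos_right hi' h]

theorem local_transition_closure (m p : ℕ)
    (w : Fin p → Fin m → ℤ) (d : Fin p → ℤ) (c : Fin m → ℤ) :
    ∀ x y : Fin m → ℤ,
      Relation.ReflTransGen
          (fun x y =>
            x ∈ halfspaceInter m p w d ∧ x + c ∈ halfspaceInter m p w d ∧ y = x + c)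
          x y ↔
        (x = y ∨
          ∃ k : ℕ, 1 ≤ k ∧ y = x + k • c ∧
            x ∈ halfspaceInter m p w d ∧ y ∈ halfspaceInter m p w d) := by
  intro x y
  constructor
  · intro h
    induction h with
    | refl => exact Or.inl rfl
    | tail _ hbc ih =>
      obtain ⟨hb, hc, rfl⟩ := hbc
      right
      rcases ih with rfl | ⟨k, hk, rfl, hx, -⟩
      · exact ⟨1, le_rfl, by simp, hb, hc⟩
      · exact ⟨k + 1, by omega, by rw [succ_nsmul, add_assoc], hx, hc⟩
  · rintro (rfl | ⟨k, -, rfl, hx, hy⟩)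
    · exact Relation.ReflTransGen.refl
    · have : ∀ i ≤ k, Relation.ReflTransGen
          (fun x y =>
            x ∈ halfspaceInter m p w d ∧ x + c ∈ halfspaceInter m p w d ∧ y = x + c)
          x (x + i • c) := by
        intro i
        induction i with
        | zero => intro _; rw [zero_nsmul, add_zero]
        | succ n ih =>
          intro hn
          have e : x + (n + 1) • c = x + n • c + c := by rw [succ_nsmul, add_assoc]
          refine (ih (by omega)).tail ⟨?_, ?_, e⟩
          · exact halfspaceInter_mid m p w d c x k n (by omega) hx hy
          · rw [← e]
            exact halfspaceInter_mid m p w d c x k (n + 1) hn hx hy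
      exact this k le_rfl
end

section
/- Let m, q : ℕ. For each branch b : Fin q let p b : ℕ, w : (b : Fin q) → Fin (p b) → (Fin m → ℤ), d : (b : Fin q) → Fin (p b) → ℤ, define the guard S b := {x : Fin m → ℤ | ∀ j : Fin (p b), d b j ≤ ∑ l, w b j l * x l}, and let c : Fin q → (Fin m → ℤ) be the translation vector of each branch. Assume the guards are pairwise disjoint: for b ≠ b', S b ∩ S b' = ∅. Define the local transition relation r x y := ∃ b : Fin q, x ∈ S b ∧ x + c b ∈ S b ∧ y = x + c b. Then for all x and y: Relation.ReflTransGen r x y holds if and only if x = y, or there exist b : Fin q and k : ℕ with 1 ≤ k such that y = x + k • (c b), x ∈ S b, and y ∈ S b. -/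
def branchGuard (m : ℕ) {q : ℕ} (p : Fin q → ℕ)
    (w : (b : Fin q) → Fin (p b) → Fin m → ℤ)
    (d : (b : Fin q) → Fin (p b) → ℤ) (b : Fin q) : Set (Fin m → ℤ) :=
  {x : Fin m → ℤ | ∀ j : Fin (p b), d b j ≤ ∑ l, w b j l * x l}

theorem guard_between (m : ℕ) {q : ℕ} (p : Fin q → ℕ)
    (w : (b : Fin q) → Fin (p b) → Fin m → ℤ)
    (d : (b : Fin q) → Fin (p b) → ℤ) (b : Fin q) (x v : Fin m → ℤ) (i k : ℕ) (hik : i ≤ k)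
    (h0 : x ∈ branchGuard m p w d b) (hk : x + k • v ∈ branchGuard m p w d b) :
    x + i • v ∈ branchGuard m p w d b := by
  have key : ∀ (n : ℕ) (j : Fin (p b)), ∑ l, w b j l * (x + n • v) l
      = ∑ l, w b j l * x l + (n : ℤ) * ∑ l, w b j l * v l := by
    intro n j
    rw [Finset.mul_sum, ← Finset.sum_add_distrib]
    refine Finset.sum_congr rfl fun l _ => ?_
    rw [Pi.add_apply, Pi.smul_apply, nsmul_eq_mul]
    ring
  intro j
  have h1 := h0 j
  have h2 := hk j
  rw [key] at h2 ⊢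
  have hik' : (i : ℤ) ≤ k := by exact_mod_cast hik
  have hi : (0 : ℤ) ≤ i := by positivity
  rcases le_total 0 (∑ l, w b j l * v l) with ht | ht
  · nlinarith [mul_nonneg hi ht]
  · nlinarith [mul_le_mul_of_nonpos_right hik' ht]

theorem local_transition_closure_multibranch (m q : ℕ) (p : Fin q → ℕ)
    (w : (b : Fin q) → Fin (p b) → Fin m → ℤ)
    (d : (b : Fin q) → Fin (p b) → ℤ)
    (c : Fin q → Fin m → ℤ)
    (hdisj : ∀ b b' : Fin q, b ≠ b' →
      branchGuard m p w d b ∩ branchGuard m p w d b' = ∅) :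
    ∀ x y : Fin m → ℤ,
      Relation.ReflTransGen
          (fun x y => ∃ b : Fin q,
            x ∈ branchGuard m p w d b ∧ x + c b ∈ branchGuard m p w d b ∧ y = x + c b)
          x y ↔
        (x = y ∨
          ∃ b : Fin q, ∃ k : ℕ, 1 ≤ k ∧ y = x + k • c b ∧
            x ∈ branchGuard m p w d b ∧ y ∈ branchGuard m p w d b) := by
  intro x y
  constructor
  · intro h
    induction h with
    | refl => exact Or.inl rfl
    | tail _ hs ih =>
      obtain ⟨b, hb1, hb2, rfl⟩ := hs
      right
      rcases ih with rfl | ⟨b', k, hk, rfl, hx, hy⟩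
      · exact ⟨b, 1, le_rfl, by simp, hb1, hb2⟩
      · have hbb : b = b' := by
          by_contra hne
          have hmem := Set.mem_inter hb1 hy
          rw [hdisj b b' hne] at hmem
          exact hmem
        subst hbb
        exact ⟨b, k + 1, by omega, by rw [succ_nsmul, add_assoc], hx, hb2⟩
  · rintro (rfl | ⟨b, k, _, rfl, hx, hy⟩)
    · exact Relation.ReflTransGen.refl
    · have main : ∀ i : ℕ, i ≤ k → Relation.ReflTransGen
          (fun x y => ∃ b : Fin q,
            x ∈ branchGuard m p w d b ∧ x + c b ∈ branchGuard m p w d b ∧ y = x + c b)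
          x (x + i • c b) := by
        intro i
        induction i with
        | zero => intro _; simpa using Relation.ReflTransGen.refl
        | succ i ih =>
          intro hi
          have e : x + (i + 1) • c b = x + i • c b + c b := by rw [succ_nsmul, add_assoc]
          refine Relation.ReflTransGen.tail (ih (by omega)) ⟨b, ?_, ?_, e⟩
          · exact guard_between m p w d b x (c b) i k (by omega) hx hy
          · rw [← e]
            exact guard_between m p w d b x (c b) (i + 1) k hi hx hy
      exact main k le_rfl
end

section
/- Let α be a type, V a finite type, π : α → V, and let l, c : α → α → Prop be relations such that l x y implies π x = π y for all x, y. Define E : V → V → Prop by E u v := ∃ x y, c x y ∧ π x = u ∧ π y = v, and assume Relation.TransGen E is irreflexive. Then for every m : ℕ and every f : ℕ → α such that for each i < m either l (f i) (f (i+1)) or c (f i) (f (i+1)) holds, the number of indices i < m at which c (f i) (f (i+1)) holds is strictly less than Fintype.card V. -/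
theorem cross_transition_count_bound {α : Type*} (V : Type*) [Fintype V]
    (π : α → V) (l c : α → α → Prop)
    (hl : ∀ x y : α, l x y → π x = π y)
    (hacyc : Irreflexive (Relation.TransGen
      (fun u v : V => ∃ x y : α, c x y ∧ π x = u ∧ π y = v)))
    (m : ℕ) (f : ℕ → α)
    (hstep : ∀ i : ℕ, i < m → l (f i) (f (i + 1)) ∨ c (f i) (f (i + 1))) :
    {i : ℕ | i < m ∧ c (f i) (f (i + 1))}.ncard < Fintype.card V := by
  classical
  set E : V → V → Prop := fun u v => ∃ x y : α, c x y ∧ π x = u ∧ π y = v with hE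
  have reach : ∀ i j : ℕ, i ≤ j → j ≤ m →
      Relation.ReflTransGen E (π (f i)) (π (f j)) := by
    intro i j hij
    induction j, hij using Nat.le_induction with
    | base => intro _; exact Relation.ReflTransGen.refl
    | succ j hij ih =>
      intro hj
      rcases hstep j (by omega) with h | h
      · rw [← hl _ _ h]
        exact ih (by omega)
      · exact (ih (by omega)).tail ⟨_, _, h, rfl, rfl⟩
  have key : ∀ i j : ℕ, i ≤ j → j < m → c (f j) (f (j + 1)) →
      π (f i) ≠ π (f (j + 1)) := by
    intro i j hij hj hc heq
    have h : Relation.TransGen E (π (f i)) (π (f (j + 1))) :=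
      Relation.TransGen.tail' (reach i j hij hj.le) ⟨_, _, hc, rfl, rfl⟩
    rw [← heq] at h
    exact hacyc _ h
  have hinj : Set.InjOn (fun i => π (f (i + 1)))
      {i : ℕ | i < m ∧ c (f i) (f (i + 1))} := by
    rintro i ⟨hi, hci⟩ j ⟨hj, hcj⟩ heq
    rcases lt_trichotomy i j with h | h | h
    · exact absurd heq (key (i + 1) j h hj hcj)
    · exact h
    · exact absurd heq.symm (key (j + 1) i h hi hci)
  rw [← Set.ncard_image_of_injOn hinj, ← Nat.card_eq_fintype_card, ← Set.ncard_univ]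
  apply Set.ncard_lt_ncard _ (Set.toFinite _)
  rw [Set.ssubset_univ_iff]
  intro h
  have h0 : π (f 0) ∈ (Set.univ : Set V) := Set.mem_univ _
  rw [← h] at h0
  obtain ⟨j, ⟨hj, hc⟩, hej⟩ := h0
  exact key 0 j (Nat.zero_le _) hj hc hej.symm
end

section
/- Let α be a type, V a finite type, π : α → V, and let l, c : α → α → Prop be relations such that l x y implies π x = π y for all x, y. Define E : V → V → Prop by E u v := ∃ x y, c x y ∧ π x = u ∧ π y = v, and assume Relation.TransGen E is irreflexive. Define relations T k : α → α → Prop recursively by T 0 := Relation.ReflTransGen l and T (k+1) x y := ∃ z w, T k x z ∧ c z w ∧ Relation.ReflTransGen l w y. Then for all x y : α, Relation.ReflTransGen (fun a b => l a b ∨ c a b) x y holds if and only if there exists k < Fintype.card V such that T k x y holds. -/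
def segRel {α : Type*} (l c : α → α → Prop) : ℕ → α → α → Prop
  | 0 => Relation.ReflTransGen l
  | k + 1 => fun x y =>
      ∃ z w, segRel l c k x z ∧ c z w ∧ Relation.ReflTransGen l w y

theorem pi_eq_of_star {α V : Type*} (π : α → V) (l : α → α → Prop)
    (hl : ∀ x y : α, l x y → π x = π y) {x y : α}
    (h : Relation.ReflTransGen l x y) : π x = π y := by
  induction h with
  | refl => rfl
  | tail _ h ih => exact ih.trans (hl _ _ h)

theorem segRel_finset {α V : Type*} (π : α → V) (l c : α → α → Prop)
    (hl : ∀ x y : α, l x y → π x = π y)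
    (hacyc : Irreflexive (Relation.TransGen
      (fun u v : V => ∃ x y : α, c x y ∧ π x = u ∧ π y = v))) (k : ℕ) :
    ∀ x y : α, segRel l c k x y → ∃ s : Finset V, s.card = k + 1 ∧
      ∀ v ∈ s, Relation.ReflTransGen
        (fun u v : V => ∃ x y : α, c x y ∧ π x = u ∧ π y = v) v (π y) := by
  classical
  induction k with
  | zero =>
    intro x y _
    refine ⟨{π y}, by simp, ?_⟩
    intro v hv
    rw [Finset.mem_singleton.1 hv]
  | succ k ih =>
    rintro x y ⟨z, w, hxz, hzw, hwy⟩
    obtain ⟨s, hs, hv⟩ := ih x z hxz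
    have hstep : ∃ a b : α, c a b ∧ π a = π z ∧ π b = π y :=
      ⟨z, w, hzw, rfl, pi_eq_of_star π l hl hwy⟩
    have hns : π y ∉ s := fun hm =>
      hacyc _ (Relation.TransGen.tail' (hv _ hm) hstep)
    refine ⟨insert (π y) s, by rw [Finset.card_insert_of_notMem hns, hs], ?_⟩
    intro v hm
    rcases Finset.mem_insert.1 hm with rfl | hm
    · exact Relation.ReflTransGen.refl
    · exact (hv v hm).tail hstep

theorem segRel_sound {α : Type*} (l c : α → α → Prop) (k : ℕ) :
    ∀ x y : α, segRel l c k x y →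
      Relation.ReflTransGen (fun a b => l a b ∨ c a b) x y := by
  induction k with
  | zero => exact fun x y h => Relation.ReflTransGen.mono (fun _ _ => Or.inl) _ _ h
  | succ k ih =>
    rintro x y ⟨z, w, hxz, hzw, hwy⟩
    exact ((ih x z hxz).tail (Or.inr hzw)).trans
      (Relation.ReflTransGen.mono (fun _ _ => Or.inl) _ _ hwy)

theorem segRel_complete {α : Type*} (l c : α → α → Prop) {x y : α}
    (h : Relation.ReflTransGen (fun a b => l a b ∨ c a b) x y) :
    ∃ k, segRel l c k x y := by
  induction h with
  | refl => exact ⟨0, Relation.ReflTransGen.refl⟩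
  | tail _ h ih =>
    obtain ⟨k, hk⟩ := ih
    rcases h with h | h
    · refine ⟨k, ?_⟩
      cases k with
      | zero => exact Relation.ReflTransGen.tail hk h
      | succ k =>
        obtain ⟨z, w, h1, h2, h3⟩ := hk
        exact ⟨z, w, h1, h2, h3.tail h⟩
    · exact ⟨k + 1, _, _, hk, h, Relation.ReflTransGen.refl⟩

theorem at_closure_finite_disjunction {α : Type*} (V : Type*) [Fintype V]
    (π : α → V) (l c : α → α → Prop)
    (hl : ∀ x y : α, l x y → π x = π y)
    (hacyc : Irreflexive (Relation.TransGen
      (fun u v : V => ∃ x y : α, c x y ∧ π x = u ∧ π y = v))) :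
    ∀ x y : α,
      Relation.ReflTransGen (fun a b => l a b ∨ c a b) x y ↔
        ∃ k : ℕ, k < Fintype.card V ∧ segRel l c k x y := by
  intro x y
  constructor
  · intro h
    obtain ⟨k, hk⟩ := segRel_complete l c h
    obtain ⟨s, hs, _⟩ := segRel_finset π l c hl hacyc k x y hk
    have := s.card_le_univ
    exact ⟨k, by omega, hk⟩
  · rintro ⟨k, _, hk⟩
    exact segRel_sound l c k x y hk
end
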